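/- There is an absolute constant C ≥ 1 such that the following holds. Let F be a finite field with q elements, n ≥ 1, and suppose A ⊆ 𝔽_q^n has |A| ≥ 2^{−d}·q^n for some real d ≥ 1. Let k ≥ 1 be an integer, ε ∈ (0, 1], and suppose ‖A ⋆ A‖_k ≥ 1 + ε, where A also denotes the density function of the set A. Then there is an affine subspace V of 𝔽_q^n with codimension at most C·(d⁴k⁴/ε² + d⁴(log(2/ε))⁴/ε⁶) such that E_{v∈V} A(v) ≥ 1 + ε/4, i.e., |A ∩ V| · q^n ≥ (1 + ε/4) · |A| · |V|. -/

import Mathlib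

open scoped Classical

/-- The density function of a set `A ⊆ G`: `(|G|/|A|)·1_A`. -/
noncomputable def dens {G : Type*} [Fintype G] (A : Finset G) : G → ℝ :=
  fun x => if x ∈ A then (Fintype.card G : ℝ) / (A.card : ℝ) else 0

/-- Cross-correlation: `(f ⋆ g)(x) = E_{y∈G} f(y)·g(x + y)`. -/
noncomputable def starC {G : Type*} [AddCommGroup G] [Fintype G] (f g : G → ℝ) : G → ℝ :=
  fun x => (∑ y, f y * g (x + y)) / (Fintype.card G : ℝ)

/-- The normalized `k`-norm: `‖f‖_k = (E_{x∈G} |f(x)|^k)^{1/k}`. -/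
noncomputable def knorm {G : Type*} [Fintype G] (k : ℕ) (f : G → ℝ) : ℝ :=
  ((∑ x, |f x| ^ k) / (Fintype.card G : ℝ)) ^ ((1:ℝ)/(k:ℝ))

/-- The real-valued indicator function of a finset. -/
noncomputable def ind {G : Type*} (S : Finset G) (x : G) : ℝ := if x ∈ S then 1 else 0

lemma ind_nonneg {G : Type*} (S : Finset G) (x : G) : 0 ≤ ind S x := by
  unfold ind; split_ifs <;> norm_num

lemma ind_le_one {G : Type*} (S : Finset G) (x : G) : ind S x ≤ 1 := by
  unfold ind; split_ifs <;> norm_num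

lemma sum_ind_mul {G : Type*} [Fintype G] (S : Finset G) (f : G → ℝ) :
    ∑ x, ind S x * f x = ∑ x ∈ S, f x := by
  simp [ind, Finset.sum_ite_mem]

lemma sum_ind {G : Type*} [Fintype G] (S : Finset G) : ∑ x, ind S x = S.card := by
  simp [ind, Finset.sum_ite_mem]

/-- One-sided Chernoff bound for the sum of `m` independent uniform samples from `B`. -/
lemma card_lt_sum_le {ι : Type*} (B : Finset ι) (h : ι → ℝ) (hb : ∀ b ∈ B, |h b| ≤ 1)
    (h0 : ∑ b ∈ B, h b = 0) (m : ℕ) (δ : ℝ) (hδ : 0 ≤ δ) (hδ1 : δ ≤ 1) :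
    (((Fintype.piFinset fun _ : Fin m => B).filter
      fun b => δ * m < ∑ i, h (b i)).card : ℝ) ≤
      Real.exp (-(δ ^ 2 * m / 4)) * (B.card : ℝ) ^ m := by
  have hmgf : ∑ b ∈ B, Real.exp (δ / 2 * h b) ≤ B.card * Real.exp (δ ^ 2 / 4) := by
    have h1 : ∀ b ∈ B, Real.exp (δ / 2 * h b) ≤ 1 + δ / 2 * h b + δ ^ 2 / 4 := by
      intro b hbB
      have h2 := hb b hbB
      have h3 : |δ / 2 * h b| ≤ δ / 2 := by
        rw [abs_mul, abs_of_nonneg (by positivity : 0 ≤ δ / 2)]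
        exact mul_le_of_le_one_right (by positivity) h2
      have h4 := abs_le.1 (Real.abs_exp_sub_one_sub_id_le (h3.trans (by linarith)))
      have h5 : (δ / 2 * h b) ^ 2 ≤ (δ / 2) ^ 2 := by
        rw [← sq_abs]; gcongr
      nlinarith
    calc _ ≤ ∑ b ∈ B, (1 + δ / 2 * h b + δ ^ 2 / 4) := Finset.sum_le_sum h1
      _ = B.card * (δ ^ 2 / 4 + 1) := by
        rw [Finset.sum_add_distrib, Finset.sum_add_distrib, ← Finset.mul_sum, h0]
        simp; ring
      _ ≤ _ := by gcongr; exact Real.add_one_le_exp _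
  have hsum : ∑ b ∈ Fintype.piFinset fun _ : Fin m => B, Real.exp (δ / 2 * ∑ i, h (b i))
      ≤ (B.card * Real.exp (δ ^ 2 / 4)) ^ m := by
    have : ∑ b ∈ Fintype.piFinset fun _ : Fin m => B, Real.exp (δ / 2 * ∑ i, h (b i))
        = (∑ b ∈ B, Real.exp (δ / 2 * h b)) ^ m := by
      rw [← Fin.prod_const, Finset.prod_univ_sum]
      simp_rw [Finset.mul_sum, Real.exp_sum]
    rw [this]
    gcongr
  have hmarkov : (((Fintype.piFinset fun _ : Fin m => B).filter
      fun b => δ * m < ∑ i, h (b i)).card : ℝ) * Real.exp (δ / 2 * (δ * m))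
      ≤ (B.card * Real.exp (δ ^ 2 / 4)) ^ m := by
    refine le_trans ?_ hsum
    rw [← nsmul_eq_mul, ← Finset.sum_const]
    refine (Finset.sum_le_sum fun b hb => ?_).trans
      (Finset.sum_le_sum_of_subset_of_nonneg (Finset.filter_subset _ _)
        fun _ _ _ => (Real.exp_pos _).le)
    have := (Finset.mem_filter.1 hb).2
    gcongr
  rw [← le_div_iff₀ (Real.exp_pos _)] at hmarkov
  refine hmarkov.trans_eq ?_
  rw [mul_pow, ← Real.exp_nat_mul, mul_div_assoc, ← Real.exp_sub, mul_comm]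
  congr 2
  ring

/-- Two-sided Chernoff bound for the sum of `m` independent uniform samples from `B`. -/
lemma card_lt_abs_sum_le {ι : Type*} (B : Finset ι) (h : ι → ℝ) (hb : ∀ b ∈ B, |h b| ≤ 1)
    (h0 : ∑ b ∈ B, h b = 0) (m : ℕ) (δ : ℝ) (hδ : 0 ≤ δ) (hδ1 : δ ≤ 1) :
    (((Fintype.piFinset fun _ : Fin m => B).filter
      fun b => δ * m < |∑ i, h (b i)|).card : ℝ) ≤
      2 * Real.exp (-(δ ^ 2 * m / 4)) * (B.card : ℝ) ^ m := by
  have h1 := card_lt_sum_le B h hb h0 m δ hδ hδ1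
  have h2 := card_lt_sum_le B (fun b => -h b) (by simpa using hb) (by simp [h0]) m δ hδ hδ1
  have h3 : ((Fintype.piFinset fun _ : Fin m => B).filter fun b => δ * m < |∑ i, h (b i)|) ⊆
      ((Fintype.piFinset fun _ : Fin m => B).filter fun b => δ * m < ∑ i, h (b i)) ∪
      ((Fintype.piFinset fun _ : Fin m => B).filter fun b => δ * m < ∑ i, -h (b i)) := by
    intro b hb
    simp only [Finset.mem_union, Finset.mem_filter, Finset.sum_neg_distrib] at hb ⊢
    rcases lt_abs.1 hb.2 with h | h
    · exact Or.inl ⟨hb.1, h⟩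
    · exact Or.inr ⟨hb.1, h⟩
  have h4 : (((Fintype.piFinset fun _ : Fin m => B).filter
      fun b => δ * m < |∑ i, h (b i)|).card : ℝ) ≤ _ :=
    Nat.cast_le.2 ((Finset.card_le_card h3).trans (Finset.card_union_le _ _))
  push_cast at h4
  linarith

/-- The proportion of `b ∈ B` with `x + b ∈ S`. -/
noncomputable def hitRate {G : Type*} [AddCommGroup G] (B S : Finset G) (x : G) : ℝ :=
  (∑ b ∈ B, ind S (x + b)) / B.card

lemma hitRate_nonneg {G : Type*} [AddCommGroup G] (B S : Finset G) (x : G) :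
    0 ≤ hitRate B S x :=
  div_nonneg (Finset.sum_nonneg fun _ _ => ind_nonneg _ _) (Nat.cast_nonneg _)

lemma hitRate_le_one {G : Type*} [AddCommGroup G] (B S : Finset G) (x : G) :
    hitRate B S x ≤ 1 := by
  refine div_le_one_of_le₀ ?_ (Nat.cast_nonneg _)
  simpa using Finset.sum_le_sum fun b (_ : b ∈ B) => ind_le_one S (x + b)

/-- At least half of all `m`-tuples of samples from `B` approximate `hitRate B S` to within `δ`
outside a small exceptional set. -/
lemma exists_good_samples {G : Type*} [AddCommGroup G] [Fintype G] (B S : Finset G)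
    (hB : B.Nonempty) (m : ℕ) (hm : 0 < m) (δ : ℝ) (hδ : 0 ≤ δ) (hδ1 : δ ≤ 1) :
    ∃ L : Finset (Fin m → G), (B.card : ℝ) ^ m / 2 ≤ L.card ∧ ∀ b ∈ L,
      ((Finset.univ.filter fun x => δ < |(∑ i, ind S (x + b i)) / m - hitRate B S x|).card : ℝ)
        ≤ 4 * Real.exp (-(δ ^ 2 * m / 4)) * Fintype.card G := by
  have hBc : (0 : ℝ) < B.card := by exact_mod_cast hB.card_pos
  have hG : (0 : ℝ) < Fintype.card G := by
    exact_mod_cast Fintype.card_pos_iff.2 ⟨hB.choose⟩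
  have hm' : (0 : ℝ) < m := by exact_mod_cast hm
  set P := Fintype.piFinset fun _ : Fin m => B with hP
  set E : (Fin m → G) → Finset G := fun b =>
    Finset.univ.filter fun x => δ < |(∑ i, ind S (x + b i)) / m - hitRate B S x| with hE
  set η := Real.exp (-(δ ^ 2 * m / 4)) with hη
  have hη0 : 0 < η := Real.exp_pos _
  have hPc : (P.card : ℝ) = (B.card : ℝ) ^ m := by simp [hP]
  have hx : ∀ x, ((P.filter fun b => x ∈ E b).card : ℝ) ≤ 2 * η * (B.card : ℝ) ^ m := by
    intro x
    have := card_lt_abs_sum_le B (fun b => ind S (x + b) - hitRate B S x) (fun b _ => by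
      rw [abs_le]
      have := hitRate_nonneg B S x
      have := hitRate_le_one B S x
      have := ind_nonneg S (x + b)
      have := ind_le_one S (x + b)
      constructor <;> linarith) (by
        rw [Finset.sum_sub_distrib, Finset.sum_const, nsmul_eq_mul, hitRate]
        field_simp; ring) m δ hδ hδ1
    refine le_trans (le_of_eq ?_) this
    congr 2
    refine Finset.filter_congr fun b _ => ?_
    simp only [hE, Finset.mem_filter, Finset.mem_univ, true_and]
    rw [← mul_lt_mul_iff_left₀ hm', ← abs_of_pos hm', ← abs_mul, abs_of_pos hm']
    rw [Finset.sum_sub_distrib, sub_mul, div_mul_cancel₀ _ hm'.ne']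
    simp [mul_comm]
  have hsum : ∑ b ∈ P, ((E b).card : ℝ) ≤ 2 * η * (B.card : ℝ) ^ m * Fintype.card G := by
    have h1 : ∑ b ∈ P, ((E b).card : ℝ) = ∑ x : G, ((P.filter fun b => x ∈ E b).card : ℝ) := by
      have h2 : ∀ b, ((E b).card : ℝ) = ∑ x : G, if x ∈ E b then (1 : ℝ) else 0 := by
        intro b; simp
      simp_rw [h2, Finset.card_filter]
      rw [Finset.sum_comm]
      push_cast
      rfl
    rw [h1]
    refine (Finset.sum_le_sum fun x _ => hx x).trans ?_
    simp [mul_comm]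
  refine ⟨P.filter fun b => ((E b).card : ℝ) ≤ 4 * η * Fintype.card G, ?_,
    fun b hb => (Finset.mem_filter.1 hb).2⟩
  have hsplit := Finset.card_filter_add_card_filter_not (s := P)
    (fun b => ((E b).card : ℝ) ≤ 4 * η * Fintype.card G)
  have hbad : ((P.filter fun b => ¬ ((E b).card : ℝ) ≤ 4 * η * Fintype.card G).card : ℝ) *
      (4 * η * Fintype.card G) ≤ ∑ b ∈ P, ((E b).card : ℝ) := by
    rw [← nsmul_eq_mul, ← Finset.sum_const]
    refine (Finset.sum_le_sum fun b hb => ?_).trans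
      (Finset.sum_le_sum_of_subset_of_nonneg (Finset.filter_subset _ _)
        fun _ _ _ => Nat.cast_nonneg _)
    exact (not_le.1 (Finset.mem_filter.1 hb).2).le
  have hbad2 : ((P.filter fun b => ¬ ((E b).card : ℝ) ≤ 4 * η * Fintype.card G).card : ℝ)
      ≤ (B.card : ℝ) ^ m / 2 := by
    have h3 : 0 < 4 * η * Fintype.card G := by positivity
    rw [← mul_le_mul_iff_left₀ h3]
    refine (hbad.trans hsum).trans (le_of_eq ?_)
    ring
  have : (P.card : ℝ) = _ := congrArg (Nat.cast (R := ℝ)) hsplit.symm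
  push_cast at this
  rw [hPc] at this
  linarith

/-- Croot–Sisask almost periodicity: `hitRate B S` hardly changes under shifts from `T`. -/
lemma exists_almost_periods {G : Type*} [AddCommGroup G] [Fintype G] (B S : Finset G)
    (hB : B.Nonempty) (m : ℕ) (hm : 0 < m) (δ : ℝ) (hδ : 0 ≤ δ) (hδ1 : δ ≤ 1) :
    ∃ T : Finset G, (Fintype.card G : ℝ) * (B.card : ℝ) ^ m / 2
        ≤ T.card * (Fintype.card G : ℝ) ^ m ∧ ∀ t ∈ T, ∀ t' ∈ T,
      ((Finset.univ.filter fun x => 2 * δ < |hitRate B S (x + t) - hitRate B S (x + t')|).card : ℝ)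
        ≤ 8 * Real.exp (-(δ ^ 2 * m / 4)) * Fintype.card G := by
  obtain ⟨L, hL, hLE⟩ := exists_good_samples B S hB m hm δ hδ hδ1
  set T : (Fin m → G) → Finset G := fun z => Finset.univ.filter fun t => (fun i => z i - t) ∈ L
    with hT
  have hcount : ∑ z, ((T z).card : ℝ) = Fintype.card G * L.card := by
    have h1 : ∀ z, ((T z).card : ℝ) = ∑ t : G, ind L (z - fun _ => t) := by
      intro z
      rw [hT]
      simp only [Finset.card_filter]
      push_cast
      exact Finset.sum_congr rfl fun t _ => by unfold ind; congr 1
    simp_rw [h1]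
    rw [Finset.sum_comm]
    have h2 : ∀ t : G, ∑ z : Fin m → G, ind L (z - fun _ => t) = L.card := by
      intro t
      rw [← sum_ind L]
      exact Fintype.sum_equiv (Equiv.subRight fun _ => t) _ _ fun _ => rfl
    simp [h2]
  obtain ⟨z, -, hz⟩ : ∃ z ∈ (Finset.univ : Finset (Fin m → G)),
      (Fintype.card G : ℝ) * L.card / (Fintype.card G : ℝ) ^ m ≤ (T z).card := by
    have hG : (0 : ℝ) < Fintype.card G := by
      exact_mod_cast Fintype.card_pos_iff.2 ⟨hB.choose⟩
    refine Finset.exists_le_of_sum_le ⟨fun _ => hB.choose, Finset.mem_univ _⟩ ?_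
    rw [hcount]
    simp
    field_simp
    rfl
  have hG : (0 : ℝ) < Fintype.card G := by
    exact_mod_cast Fintype.card_pos_iff.2 ⟨hB.choose⟩
  refine ⟨T z, ?_, ?_⟩
  · rw [div_le_iff₀ (by positivity)] at hz
    refine le_trans ?_ hz
    rw [mul_div_assoc]
    gcongr
  · intro t ht t' ht'
    have key : ∀ t ∈ T z, ((Finset.univ.filter fun x =>
        δ < |(∑ i, ind S (x + z i)) / m - hitRate B S (x + t)|).card : ℝ)
        ≤ 4 * Real.exp (-(δ ^ 2 * m / 4)) * Fintype.card G := by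
      intro t ht
      refine le_trans (le_of_eq ?_) (hLE _ (Finset.mem_filter.1 ht).2)
      congr 1
      refine Finset.card_equiv (Equiv.addRight t) fun x => ?_
      simp
    have h3 : (Finset.univ.filter fun x =>
        2 * δ < |hitRate B S (x + t) - hitRate B S (x + t')|) ⊆
        (Finset.univ.filter fun x =>
          δ < |(∑ i, ind S (x + z i)) / m - hitRate B S (x + t)|) ∪
        (Finset.univ.filter fun x =>
          δ < |(∑ i, ind S (x + z i)) / m - hitRate B S (x + t')|) := by
      intro x hx
      simp only [Finset.mem_union, Finset.mem_filter, Finset.mem_univ, true_and] at hx ⊢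
      by_contra! hcon
      have h4 := abs_sub_le (hitRate B S (x + t)) ((∑ i, ind S (x + z i)) / m)
        (hitRate B S (x + t'))
      rw [abs_sub_comm] at hcon
      linarith [hcon.1, hcon.2]
    have h4 : ((Finset.univ.filter fun x =>
        2 * δ < |hitRate B S (x + t) - hitRate B S (x + t')|).card : ℝ) ≤ _ :=
      Nat.cast_le.2 ((Finset.card_le_card h3).trans (Finset.card_union_le _ _))
    push_cast at h4
    linarith [key t' ht', key t ht]

/-- The law of `z - y + ∑ i < l, (tᵢ - tᵢ')` for independent uniform `y, z ∈ B` and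
`tᵢ, tᵢ' ∈ T`. -/
noncomputable def walk {G : Type*} [AddCommGroup G] (B T : Finset G) : ℕ → G → ℝ
  | 0, g => (∑ y ∈ B, ∑ z ∈ B, if z - y = g then 1 else 0) / (B.card : ℝ) ^ 2
  | l + 1, g => (∑ t ∈ T, ∑ t' ∈ T, walk B T l (g - t + t')) / (T.card : ℝ) ^ 2

lemma walk_nonneg {G : Type*} [AddCommGroup G] (B T : Finset G) (l : ℕ) (g : G) :
    0 ≤ walk B T l g := by
  induction l generalizing g with
  | zero =>
    refine div_nonneg (Finset.sum_nonneg fun _ _ => Finset.sum_nonneg fun _ _ => ?_) (by positivity)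
    split_ifs <;> norm_num
  | succ l ih =>
    exact div_nonneg (Finset.sum_nonneg fun _ _ => Finset.sum_nonneg fun _ _ => ih _)
      (by positivity)

lemma sum_walk_zero_mul {G : Type*} [AddCommGroup G] [Fintype G] (B T : Finset G) (h : G → ℝ) :
    ∑ g, walk B T 0 g * h g = (∑ y ∈ B, ∑ z ∈ B, h (z - y)) / (B.card : ℝ) ^ 2 := by
  simp only [walk, div_mul_eq_mul_div, Finset.sum_mul]
  rw [← Finset.sum_div, Finset.sum_comm]
  congr 1
  refine Finset.sum_congr rfl fun y _ => ?_
  rw [Finset.sum_comm]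
  simp

lemma sum_walk_succ_mul {G : Type*} [AddCommGroup G] [Fintype G] (B T : Finset G) (l : ℕ)
    (h : G → ℝ) :
    ∑ g, walk B T (l + 1) g * h g =
      (∑ t ∈ T, ∑ t' ∈ T, ∑ g, walk B T l g * h (g + t - t')) / (T.card : ℝ) ^ 2 := by
  simp only [walk, div_mul_eq_mul_div, Finset.sum_mul]
  rw [← Finset.sum_div, Finset.sum_comm]
  congr 1
  refine Finset.sum_congr rfl fun t _ => ?_
  rw [Finset.sum_comm]
  refine Finset.sum_congr rfl fun t' _ => ?_
  refine Fintype.sum_equiv (Equiv.addRight (-t + t')) _ _ fun g => ?_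
  simp only [Equiv.coe_addRight]
  congr 2 <;> abel

lemma sum_walk {G : Type*} [AddCommGroup G] [Fintype G] {B T : Finset G} (hB : B.Nonempty)
    (hT : T.Nonempty) (l : ℕ) : ∑ g, walk B T l g = 1 := by
  have hB' : (B.card : ℝ) ≠ 0 := by exact_mod_cast hB.card_pos.ne'
  have hT' : (T.card : ℝ) ≠ 0 := by exact_mod_cast hT.card_pos.ne'
  induction l with
  | zero =>
    have := sum_walk_zero_mul B T 1
    simp only [Pi.one_apply, mul_one] at this
    rw [this]
    simp
    field_simp
  | succ l ih =>
    have := sum_walk_succ_mul B T l 1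
    simp only [Pi.one_apply, mul_one, ih] at this
    rw [this]
    simp
    field_simp

/-- Shifting by an almost period hardly changes the probability that the walk hits `S`. -/
lemma abs_walk_shift_le {G : Type*} [AddCommGroup G] [Fintype G] {B S T : Finset G}
    (hB : B.Nonempty) (hT : T.Nonempty) {δ ρ : ℝ} (hδ : 0 ≤ δ)
    (h : ∀ t ∈ T, ∀ t' ∈ T,
      ((Finset.univ.filter fun x => δ < |hitRate B S (x + t) - hitRate B S (x + t')|).card : ℝ)
        ≤ ρ) (l : ℕ) {t t' : G} (ht : t ∈ T) (ht' : t' ∈ T) (c : G) :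
    |∑ g, walk B T l g * ind S (g + (c + t)) - ∑ g, walk B T l g * ind S (g + (c + t'))|
      ≤ δ + ρ / B.card := by
  have hB' : (0 : ℝ) < B.card := by exact_mod_cast hB.card_pos
  have hT' : (0 : ℝ) < T.card := by exact_mod_cast hT.card_pos
  induction l generalizing c with
  | zero =>
    have h0 : ∀ c, ∑ g, walk B T 0 g * ind S (g + c)
        = (∑ y ∈ B, hitRate B S (c - y)) / B.card := by
      intro c
      rw [sum_walk_zero_mul B T fun g => ind S (g + c)]
      simp only [hitRate]
      rw [← Finset.sum_div, div_div, sq]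
      congr 1
      refine Finset.sum_congr rfl fun y _ => Finset.sum_congr rfl fun z _ => ?_
      congr 1; abel
    rw [h0, h0, ← sub_div, abs_div, abs_of_pos hB', div_le_iff₀ hB', ← Finset.sum_sub_distrib]
    set E := Finset.univ.filter fun x => δ < |hitRate B S (x + t) - hitRate B S (x + t')| with hE
    have h1 : ∀ y ∈ B, |hitRate B S (c + t - y) - hitRate B S (c + t' - y)|
        ≤ δ + ind E (c - y) := by
      intro y _
      rw [show c + t - y = c - y + t by abel, show c + t' - y = c - y + t' by abel]
      unfold ind
      split_ifs with hy
      · have := hitRate_nonneg B S (c - y + t)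
        have := hitRate_nonneg B S (c - y + t')
        have := hitRate_le_one B S (c - y + t)
        have := hitRate_le_one B S (c - y + t')
        rw [abs_le]; constructor <;> linarith
      · simp only [hE, Finset.mem_filter, Finset.mem_univ, true_and, not_lt] at hy
        linarith
    have h2 : ∑ y ∈ B, ind E (c - y) ≤ ρ := by
      refine le_trans ?_ (h t ht t' ht')
      rw [← sum_ind]
      refine (Finset.sum_le_sum_of_subset_of_nonneg (Finset.subset_univ _)
        fun _ _ _ => ind_nonneg _ _).trans (le_of_eq ?_)
      exact Fintype.sum_equiv (Equiv.subLeft c) _ _ fun _ => rfl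
    refine (Finset.abs_sum_le_sum_abs _ _).trans ((Finset.sum_le_sum h1).trans ?_)
    rw [Finset.sum_add_distrib, add_mul, div_mul_cancel₀ _ hB'.ne']
    simp only [Finset.sum_const, nsmul_eq_mul]
    linarith
  | succ l ih =>
    rw [sum_walk_succ_mul B T l fun g => ind S (g + (c + t)),
      sum_walk_succ_mul B T l fun g => ind S (g + (c + t')), ← sub_div, abs_div,
      abs_of_pos (by positivity : (0 : ℝ) < (T.card : ℝ) ^ 2), div_le_iff₀ (by positivity),
      ← Finset.sum_sub_distrib]
    simp_rw [← Finset.sum_sub_distrib (s := T)]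
    have h1 : ∀ s ∈ T, ∀ s' ∈ T, |∑ g, walk B T l g * ind S (g + s - s' + (c + t)) -
        ∑ g, walk B T l g * ind S (g + s - s' + (c + t'))| ≤ δ + ρ / B.card := by
      intro s _ s' _
      refine le_trans (le_of_eq ?_) (ih (c + s - s'))
      congr 2 <;> refine Finset.sum_congr rfl fun g _ => ?_ <;> congr 2 <;> abel
    refine (Finset.abs_sum_le_sum_abs _ _).trans ((Finset.sum_le_sum fun s hs =>
      (Finset.abs_sum_le_sum_abs _ _).trans (Finset.sum_le_sum fun s' hs' =>
        h1 s hs s' hs')).trans (le_of_eq ?_))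
    simp only [Finset.sum_const, nsmul_eq_mul]
    ring

/-- The walk hits `S` with nearly the same probability at time `l` as at time `0`. -/
lemma walk_zero_sub_le {G : Type*} [AddCommGroup G] [Fintype G] {B S T : Finset G}
    (hB : B.Nonempty) (hT : T.Nonempty) {δ ρ : ℝ} (hδ : 0 ≤ δ)
    (h : ∀ t ∈ T, ∀ t' ∈ T,
      ((Finset.univ.filter fun x => δ < |hitRate B S (x + t) - hitRate B S (x + t')|).card : ℝ)
        ≤ ρ) (l : ℕ) :
    ∑ g, walk B T 0 g * ind S g - l * (δ + ρ / B.card) ≤ ∑ g, walk B T l g * ind S g := by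
  have hT' : (0 : ℝ) < T.card := by exact_mod_cast hT.card_pos
  induction l with
  | zero => simp
  | succ l ih =>
    have h1 : ∑ g, walk B T l g * ind S g - (δ + ρ / B.card)
        ≤ ∑ g, walk B T (l + 1) g * ind S g := by
      rw [sum_walk_succ_mul B T l (ind S), le_div_iff₀ (by positivity)]
      have h2 : ∀ t ∈ T, ∀ t' ∈ T, ∑ g, walk B T l g * ind S g - (δ + ρ / B.card)
          ≤ ∑ g, walk B T l g * ind S (g + t - t') := by
        intro t ht t' ht'
        have := (abs_le.1 (abs_walk_shift_le hB hT hδ h l ht ht' (-t'))).1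
        simp only [neg_add_cancel, add_zero] at this
        have h3 : ∀ g, g + (-t' + t) = g + t - t' := fun g => by abel
        simp only [h3] at this
        linarith
      refine le_trans (le_of_eq ?_)
        (Finset.sum_le_sum fun t ht => Finset.sum_le_sum fun t' ht' => h2 t ht t' ht')
      simp only [Finset.sum_const, nsmul_eq_mul]
      ring
    push_cast
    linarith

/-- The Fourier coefficient at `χ` of the uniform probability measure on `T`. -/
noncomputable def fourierUnif {G : Type*} [AddCommGroup G] (T : Finset G) (χ : AddChar G ℂ) : ℂ :=
  (∑ t ∈ T, χ t) / T.card

lemma sum_sum_addChar_sub {G : Type*} [AddCommGroup G] [Fintype G] (T : Finset G)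
    (χ : AddChar G ℂ) :
    (∑ t ∈ T, ∑ t' ∈ T, χ (t' - t)) / (T.card : ℂ) ^ 2 = (‖fourierUnif T χ‖ : ℂ) ^ 2 := by
  rw [← Complex.conj_mul', fourierUnif, map_div₀, map_sum, div_mul_div_comm, Finset.sum_mul_sum]
  simp only [Complex.conj_natCast, ← sq]
  congr 1
  refine Finset.sum_congr rfl fun t _ => Finset.sum_congr rfl fun t' _ => ?_
  rw [sub_eq_add_neg, AddChar.map_add_eq_mul, AddChar.map_neg_eq_conj, mul_comm]

lemma sum_walk_mul_addChar {G : Type*} [AddCommGroup G] [Fintype G] (B T : Finset G) (l : ℕ)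
    (χ : AddChar G ℂ) :
    ∑ g, (walk B T l g : ℂ) * χ g =
      ((‖fourierUnif B χ‖ ^ 2 * (‖fourierUnif T χ‖ ^ 2) ^ l : ℝ) : ℂ) := by
  induction l with
  | zero =>
    push_cast
    rw [pow_zero, mul_one, ← sum_sum_addChar_sub]
    simp only [walk]
    push_cast
    simp only [div_mul_eq_mul_div, Finset.sum_mul]
    rw [← Finset.sum_div, Finset.sum_comm]
    congr 1
    refine Finset.sum_congr rfl fun y _ => ?_
    rw [Finset.sum_comm]
    simp [apply_ite Complex.ofReal]
  | succ l ih =>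
    have h1 : ∀ t t' : G, ∑ g, (walk B T l (g - t + t') : ℂ) * χ g
        = χ (t - t') * ∑ g, (walk B T l g : ℂ) * χ g := by
      intro t t'
      rw [Finset.mul_sum]
      refine Fintype.sum_equiv (Equiv.addRight (-t + t')) _ _ fun g => ?_
      simp only [Equiv.coe_addRight]
      rw [mul_left_comm, ← AddChar.map_add_eq_mul]
      congr 2
      · congr 1; abel
      · abel
    simp only [walk]
    push_cast
    simp only [div_mul_eq_mul_div, Finset.sum_mul]
    rw [← Finset.sum_div, Finset.sum_comm]
    have h2 : ∀ t ∈ T, ∑ g, ∑ t' ∈ T, (walk B T l (g - t + t') : ℂ) * χ g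
        = (∑ t' ∈ T, χ (t - t')) * ∑ g, (walk B T l g : ℂ) * χ g := by
      intro t _
      rw [Finset.sum_comm, Finset.sum_mul]
      exact Finset.sum_congr rfl fun t' _ => h1 t t'
    rw [Finset.sum_congr rfl h2, ← Finset.sum_mul, Finset.sum_comm, mul_div_right_comm,
      sum_sum_addChar_sub, ih]
    push_cast
    ring

/-- Fourier inversion for `walk` along a family of characters satisfying orthogonality. -/
lemma card_mul_walk {G ι : Type*} [AddCommGroup G] [Fintype G] [Fintype ι] (e : ι → AddChar G ℂ)
    (he : ∀ x, ∑ v, e v x = if x = 0 then (Fintype.card G : ℂ) else 0) (B T : Finset G) (l : ℕ)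
    (g : G) :
    (Fintype.card G : ℂ) * walk B T l g =
      ∑ v, ((‖fourierUnif B (e v)‖ ^ 2 * (‖fourierUnif T (e v)‖ ^ 2) ^ l : ℝ) : ℂ) * e v (-g) := by
  simp_rw [← sum_walk_mul_addChar, Finset.sum_mul, mul_assoc, ← AddChar.map_add_eq_mul]
  rw [Finset.sum_comm]
  simp_rw [← Finset.mul_sum, he, ← sub_eq_add_neg, sub_eq_zero]
  simp [mul_comm]

lemma sum_norm_fourierUnif_sq {G ι : Type*} [AddCommGroup G] [Fintype G] [Fintype ι]
    (e : ι → AddChar G ℂ) (he : ∀ x, ∑ v, e v x = if x = 0 then (Fintype.card G : ℂ) else 0)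
    {B : Finset G} (hB : B.Nonempty) :
    ∑ v, ‖fourierUnif B (e v)‖ ^ 2 = Fintype.card G / B.card := by
  have hB' : (B.card : ℝ) ≠ 0 := by exact_mod_cast hB.card_pos.ne'
  have h := card_mul_walk e he B B 0 0
  simp only [neg_zero, AddChar.map_zero_eq_one, mul_one, pow_zero, walk, sub_eq_zero] at h
  norm_cast at h
  rw [← h]
  simp
  field_simp

/-- After `l` steps the walk is nearly invariant under shifts annihilated by the large spectrum
of `T`. -/
lemma abs_walk_sub_walk_le {G ι : Type*} [AddCommGroup G] [Fintype G] [Fintype ι]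
    (e : ι → AddChar G ℂ) (he : ∀ x, ∑ v, e v x = if x = 0 then (Fintype.card G : ℂ) else 0)
    {B T : Finset G} (hB : B.Nonempty) (l : ℕ) {w : G}
    (hw : ∀ v, 1 / 2 < ‖fourierUnif T (e v)‖ → e v w = 1) (g : G) :
    |walk B T l (g - w) - walk B T l g| ≤ 2 * (1 / 4) ^ l / B.card := by
  have hG : (0 : ℝ) < Fintype.card G := by
    exact_mod_cast Fintype.card_pos_iff.2 ⟨w⟩
  have h1 : (Fintype.card G : ℂ) * ((walk B T l (g - w) - walk B T l g : ℝ) : ℂ) =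
      ∑ v, ((‖fourierUnif B (e v)‖ ^ 2 * (‖fourierUnif T (e v)‖ ^ 2) ^ l : ℝ) : ℂ) *
        (e v (-g) * (e v w - 1)) := by
    push_cast
    rw [mul_sub, card_mul_walk e he, card_mul_walk e he, ← Finset.sum_sub_distrib]
    refine Finset.sum_congr rfl fun v _ => ?_
    rw [show -(g - w) = -g + w by abel, AddChar.map_add_eq_mul]
    push_cast
    ring
  have h2 : ∀ v, ‖((‖fourierUnif B (e v)‖ ^ 2 * (‖fourierUnif T (e v)‖ ^ 2) ^ l : ℝ) : ℂ) *
        (e v (-g) * (e v w - 1))‖ ≤ 2 * (1 / 4) ^ l * ‖fourierUnif B (e v)‖ ^ 2 := by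
    intro v
    by_cases hv : 1 / 2 < ‖fourierUnif T (e v)‖
    · rw [hw v hv]
      simp
    · have h3 : (‖fourierUnif T (e v)‖ ^ 2) ^ l ≤ (1 / 4) ^ l := by
        have := not_lt.1 hv
        have h4 := norm_nonneg (fourierUnif T (e v))
        gcongr
        nlinarith
      have h5 : ‖e v w - 1‖ ≤ 2 := by
        refine (norm_sub_le _ _).trans ?_
        rw [AddChar.norm_apply, norm_one]; norm_num
      rw [norm_mul, norm_mul, AddChar.norm_apply, one_mul, Complex.norm_real, Real.norm_eq_abs,
        abs_of_nonneg (by positivity)]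
      calc _ ≤ ‖fourierUnif B (e v)‖ ^ 2 * (1 / 4) ^ l * 2 := by gcongr
        _ = _ := by ring
  have h6 := congrArg norm h1
  rw [norm_mul, Complex.norm_real, Complex.norm_natCast, Real.norm_eq_abs] at h6
  have h7 : (Fintype.card G : ℝ) * |walk B T l (g - w) - walk B T l g| ≤
      2 * (1 / 4) ^ l * (Fintype.card G / B.card) := by
    rw [h6, ← sum_norm_fourierUnif_sq e he hB, Finset.mul_sum]
    exact (norm_sum_le _ _).trans (Finset.sum_le_sum fun v _ => h2 v)
  rw [← mul_le_mul_iff_right₀ hG]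
  refine h7.trans_eq ?_
  ring

/-- After `l` steps the probability that the walk hits `S` is nearly invariant under shifts
annihilated by the large spectrum of `T`. -/
lemma walk_hit_sub_le {G ι : Type*} [AddCommGroup G] [Fintype G] [Fintype ι]
    (e : ι → AddChar G ℂ) (he : ∀ x, ∑ v, e v x = if x = 0 then (Fintype.card G : ℂ) else 0)
    {B T : Finset G} (hB : B.Nonempty) (S : Finset G) (l : ℕ) {w : G}
    (hw : ∀ v, 1 / 2 < ‖fourierUnif T (e v)‖ → e v w = 1) :
    ∑ g, walk B T l g * ind S g - 2 * (1 / 4) ^ l * Fintype.card G / B.card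
      ≤ ∑ g, walk B T l g * ind S (g + w) := by
  have h1 : ∑ g, walk B T l g * ind S (g + w) = ∑ g, walk B T l (g - w) * ind S g :=
    Fintype.sum_equiv (Equiv.addRight w) _ _ fun g => by simp
  have h2 : ∀ g, walk B T l g * ind S g - 2 * (1 / 4) ^ l / B.card
      ≤ walk B T l (g - w) * ind S g := by
    intro g
    have h3 := (abs_le.1 (abs_walk_sub_walk_le e he hB l hw g)).1
    have h4 := ind_nonneg S g
    have h5 := ind_le_one S g
    have h6 : (0 : ℝ) ≤ 2 * (1 / 4) ^ l / B.card := by positivity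
    nlinarith
  rw [h1]
  refine le_trans (le_of_eq ?_) (Finset.sum_le_sum fun g _ => h2 g)
  rw [Finset.sum_sub_distrib]
  simp
  ring

/-- The character `x ↦ ψ (v ⬝ x)` of `𝔽_q^n`. -/
noncomputable def dotChar {F : Type*} [Field F] {n : ℕ} (ψ : AddChar F ℂ) (v : Fin n → F) :
    AddChar (Fin n → F) ℂ where
  toFun x := ψ (v ⬝ᵥ x)
  map_zero_eq_one' := by simp
  map_add_eq_mul' x y := by rw [dotProduct_add, AddChar.map_add_eq_mul]

lemma dotChar_apply {F : Type*} [Field F] {n : ℕ} (ψ : AddChar F ℂ) (v x : Fin n → F) :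
    dotChar ψ v x = ψ (v ⬝ᵥ x) := rfl

lemma sum_dotChar {F : Type*} [Field F] [Fintype F] {n : ℕ} {ψ : AddChar F ℂ} (hψ : ψ ≠ 1)
    (x : Fin n → F) :
    ∑ v, dotChar ψ v x = if x = 0 then (Fintype.card (Fin n → F) : ℂ) else 0 := by
  split_ifs with hx
  · simp [hx]
  · have h1 : ∀ v, dotChar ψ v x = dotChar ψ x v := fun v => by
      rw [dotChar_apply, dotChar_apply, dotProduct_comm]
    simp_rw [h1]
    refine AddChar.sum_eq_zero_of_ne_one ?_
    obtain ⟨a, ha⟩ := AddChar.ne_one_iff.1 hψ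
    obtain ⟨i, hi⟩ := Function.ne_iff.1 hx
    refine AddChar.ne_one_iff.2 ⟨Pi.single i ((x i)⁻¹ * a), ?_⟩
    rwa [dotChar_apply, dotProduct_single, mul_inv_cancel_left₀ hi]

/-- The coordinates `x ↦ vᵢ ⬝ x` for linearly independent `vᵢ` are independent and uniform. -/
lemma sum_mulVec_eq {F : Type*} [Field F] [Fintype F] {n r : ℕ} {v : Fin r → Fin n → F}
    (hv : LinearIndependent F v) (Φ : (Fin r → F) → ℝ) :
    (Fintype.card (Fin r → F) : ℝ) * ∑ x, Φ (fun i => v i ⬝ᵥ x) =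
      Fintype.card (Fin n → F) * ∑ y, Φ y := by
  set M := Matrix.mulVecLin (Matrix.of v) with hM
  have hMx : ∀ x, M x = fun i => v i ⬝ᵥ x := fun x => rfl
  have hsurj : Function.Surjective M := by
    rw [← LinearMap.range_eq_top]
    refine Submodule.eq_top_of_finrank_eq ?_
    have := LinearIndependent.rank_matrix (M := Matrix.of v) hv
    rw [Matrix.rank] at this
    rw [this]; simp
  obtain ⟨s, hs⟩ := hsurj.hasRightInverse
  have h1 : ∀ y, ∑ x, Φ (M x) = ∑ x, Φ (M x + y) := by
    intro y
    refine (Fintype.sum_equiv (Equiv.addRight (s y)) _ _ fun x => ?_).symm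
    simp [hs y]
  have h2 : ∑ y : Fin r → F, ∑ x, Φ (M x) = ∑ y : Fin r → F, ∑ x, Φ (M x + y) :=
    Finset.sum_congr rfl fun y _ => h1 y
  rw [Finset.sum_comm (f := fun y x => Φ (M x + y))] at h2
  have h3 : ∀ x, ∑ y, Φ (M x + y) = ∑ y, Φ y := fun x =>
    Fintype.sum_equiv (Equiv.addLeft (M x)) _ _ fun y => by simp
  simp_rw [h3] at h2
  simpa [hMx] using h2

lemma sum_exp_re_mul_addChar_le {F : Type*} [Field F] [Fintype F] {ψ : AddChar F ℂ}
    (hψ : ψ ≠ 1) {c : ℂ} (hc : ‖c‖ ≤ 1) :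
    ∑ a, Real.exp (1 / 4 * (c * ψ a).re) ≤ Fintype.card F * Real.exp (1 / 16) := by
  have h1 : ∀ a, Real.exp (1 / 4 * (c * ψ a).re) ≤ 1 + 1 / 4 * (c * ψ a).re + 1 / 16 := by
    intro a
    have h2 : |(c * ψ a).re| ≤ 1 := by
      refine (Complex.abs_re_le_norm _).trans ?_
      rw [norm_mul, AddChar.norm_apply, mul_one]
      exact hc
    have h3 : |1 / 4 * (c * ψ a).re| ≤ 1 := by
      rw [abs_mul, abs_of_pos (by norm_num : (0 : ℝ) < 1 / 4)]
      linarith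
    have h4 := (abs_le.1 (Real.abs_exp_sub_one_sub_id_le h3)).2
    have h5 : (c * ψ a).re ^ 2 ≤ 1 := by
      rw [← sq_abs]; exact pow_le_one₀ (abs_nonneg _) h2
    nlinarith
  have h6 : ∑ a, (c * ψ a).re = 0 := by
    rw [← Complex.re_sum, ← Finset.mul_sum, AddChar.sum_eq_zero_of_ne_one hψ]
    simp
  calc _ ≤ ∑ a : F, (1 + 1 / 4 * (c * ψ a).re + 1 / 16) := Finset.sum_le_sum fun a _ => h1 a
    _ = Fintype.card F * (1 / 16 + 1) := by
      rw [Finset.sum_add_distrib, Finset.sum_add_distrib, ← Finset.mul_sum, h6]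
      simp; ring
    _ ≤ _ := by gcongr; exact Real.add_one_le_exp _

/-- Chang's inequality for linearly independent frequencies in the large spectrum. -/
lemma card_le_of_linearIndependent_spectrum {F : Type*} [Field F] [Fintype F] {n r : ℕ}
    {ψ : AddChar F ℂ} (hψ : ψ ≠ 1) {T : Finset (Fin n → F)} (hT : T.Nonempty)
    {v : Fin r → Fin n → F} (hv : LinearIndependent F v)
    (hspec : ∀ i, 1 / 2 < ‖fourierUnif T (dotChar ψ (v i))‖) :
    (r : ℝ) ≤ 16 * Real.log (Fintype.card (Fin n → F) / T.card) := by
  have hT' : (0 : ℝ) < T.card := by exact_mod_cast hT.card_pos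
  have hG : (0 : ℝ) < Fintype.card (Fin n → F) := by exact_mod_cast Fintype.card_pos
  set z : Fin r → ℂ := fun i => fourierUnif T (dotChar ψ (v i)) with hz
  set c : Fin r → ℂ := fun i => (starRingEnd ℂ) (z i) / ‖z i‖ with hc
  have hzpos : ∀ i, 0 < ‖z i‖ := fun i => lt_trans (by norm_num) (hspec i)
  have hcn : ∀ i, ‖c i‖ ≤ 1 := by
    intro i
    rw [hc]
    simp [(hzpos i).ne']
  set h : (Fin n → F) → ℝ := fun x => ∑ i, 1 / 4 * (c i * ψ (v i ⬝ᵥ x)).re with hh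
  have hmean : (r : ℝ) / 8 ≤ ∑ t ∈ T, (T.card : ℝ)⁻¹ * h t := by
    have h1 : ∀ i, ∑ t ∈ T, (T.card : ℝ)⁻¹ * (1 / 4 * (c i * ψ (v i ⬝ᵥ t)).re) = ‖z i‖ / 4 := by
      intro i
      have h2 : c i * z i = (‖z i‖ : ℂ) := by
        have : (‖z i‖ : ℂ) ≠ 0 := by exact_mod_cast (hzpos i).ne'
        rw [hc]
        simp only
        rw [div_mul_eq_mul_div, Complex.conj_mul']
        field_simp
      have h3 : ∑ t ∈ T, (c i * ψ (v i ⬝ᵥ t)).re = T.card * ‖z i‖ := by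
        have h4 : ∑ t ∈ T, ψ (v i ⬝ᵥ t) = T.card * z i := by
          simp only [hz, fourierUnif, dotChar_apply]
          have : (T.card : ℂ) ≠ 0 := by exact_mod_cast hT.card_pos.ne'
          field_simp
        rw [← Complex.re_sum, ← Finset.mul_sum, h4, mul_left_comm, h2]
        norm_cast
      rw [← Finset.mul_sum, ← Finset.mul_sum, h3]
      field_simp
    simp_rw [hh, Finset.mul_sum]
    rw [Finset.sum_comm]
    simp_rw [h1]
    calc (r : ℝ) / 8 = ∑ i : Fin r, (1 / 8 : ℝ) := by simp; ring
      _ ≤ _ := Finset.sum_le_sum fun i _ => by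
        have := hspec i
        simp only [hz]
        linarith
  have hjensen : Real.exp (∑ t ∈ T, (T.card : ℝ)⁻¹ * h t)
      ≤ ∑ t ∈ T, (T.card : ℝ)⁻¹ * Real.exp (h t) :=
    convexOn_exp.map_sum_le (fun _ _ => by positivity) (by simp [hT'.ne']) (fun _ _ => Set.mem_univ _)
  have hprod : ∑ x, Real.exp (h x) ≤ Fintype.card (Fin n → F) * Real.exp (1 / 16) ^ r := by
    have h1 := sum_mulVec_eq hv (fun y => Real.exp (∑ i, 1 / 4 * (c i * ψ (y i)).re))
    have h2 : ∑ y : Fin r → F, Real.exp (∑ i, 1 / 4 * (c i * ψ (y i)).re)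
        ≤ (Fintype.card F * Real.exp (1 / 16)) ^ r := by
      simp_rw [Real.exp_sum]
      rw [← Fintype.prod_sum (fun i a => Real.exp (1 / 4 * (c i * ψ a).re)), ← Fin.prod_const]
      exact Finset.prod_le_prod (fun i _ => Finset.sum_nonneg fun _ _ => (Real.exp_pos _).le)
        fun i _ => sum_exp_re_mul_addChar_le hψ (hcn i)
    have hF : (0 : ℝ) < Fintype.card (Fin r → F) := by exact_mod_cast Fintype.card_pos
    rw [← mul_le_mul_iff_right₀ hF]
    refine (h1.le.trans (mul_le_mul_of_nonneg_left h2 hG.le)).trans_eq ?_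
    rw [mul_pow]
    simp
    ring
  have hfinal : Real.exp (r / 16) ≤ Fintype.card (Fin n → F) / T.card := by
    have h1 : Real.exp (r / 8) ≤ Fintype.card (Fin n → F) / T.card * Real.exp (r / 16) := by
      refine (Real.exp_le_exp.2 hmean).trans (hjensen.trans ?_)
      rw [← Finset.mul_sum]
      have h2 : ∑ t ∈ T, Real.exp (h t) ≤ ∑ t, Real.exp (h t) :=
        Finset.sum_le_sum_of_subset_of_nonneg (Finset.subset_univ _)
          fun _ _ _ => (Real.exp_pos _).le
      have h3 : Real.exp (1 / 16) ^ r = Real.exp (r / 16) := by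
        rw [← Real.exp_nat_mul]; congr 1; ring
      rw [h3] at hprod
      refine (mul_le_mul_of_nonneg_left (h2.trans hprod) (by positivity)).trans_eq ?_
      ring
    have h4 : Real.exp (r / 8 : ℝ) = Real.exp (r / 16) * Real.exp (r / 16) := by
      rw [← Real.exp_add]; congr 1; ring
    rw [h4] at h1
    exact le_of_mul_le_mul_right h1 (Real.exp_pos _)
  have := (Real.le_log_iff_exp_le (by positivity)).2 hfinal
  linarith

/-- Chang's theorem: the large spectrum of `T` is annihilated by a subspace of codimension
`O(log (q ^ n / |T|))`. -/
lemma exists_submodule_annihilating_spectrum {F : Type*} [Field F] [Fintype F] {n : ℕ}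
    {ψ : AddChar F ℂ} (hψ : ψ ≠ 1) {T : Finset (Fin n → F)} (hT : T.Nonempty) :
    ∃ W : Submodule F (Fin n → F),
      (n : ℝ) - Module.finrank F W ≤ 16 * Real.log (Fintype.card (Fin n → F) / T.card) ∧
      ∀ w ∈ W, ∀ v, 1 / 2 < ‖fourierUnif T (dotChar ψ v)‖ → dotChar ψ v w = 1 := by
  obtain ⟨v, hvs, hspan, hli⟩ := Submodule.exists_fun_fin_finrank_span_eq F
    {v : Fin n → F | 1 / 2 < ‖fourierUnif T (dotChar ψ v)‖}
  refine ⟨LinearMap.ker (Matrix.mulVecLin (Matrix.of v)), ?_, ?_⟩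
  · refine le_trans ?_ (card_le_of_linearIndependent_spectrum hψ hT hli hvs)
    have h1 := LinearMap.finrank_range_add_finrank_ker (Matrix.mulVecLin (Matrix.of v))
    have h2 := Submodule.finrank_le (LinearMap.range (Matrix.mulVecLin (Matrix.of v)))
    rw [Module.finrank_fin_fun] at h1 h2
    rw [sub_le_iff_le_add]
    exact_mod_cast h1 ▸ Nat.add_le_add_right h2 _
  · intro w hw u hu
    have h1 : u ∈ Submodule.span F (Set.range v) := by
      rw [hspan]; exact Submodule.subset_span hu
    clear hu
    have h2 : u ⬝ᵥ w = 0 := by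
      induction h1 using Submodule.span_induction with
      | mem x hx =>
        obtain ⟨i, rfl⟩ := hx
        exact congrFun (LinearMap.mem_ker.1 hw) i
      | zero => simp
      | add x y _ _ hx hy => rw [add_dotProduct, hx, hy, add_zero]
      | smul a x _ hx => rw [smul_dotProduct, hx, smul_zero]
    rw [dotChar_apply, h2, AddChar.map_zero_eq_one]

/-- The number of pairs in `A` with difference `x`. -/
noncomputable def rep {G : Type*} [AddCommGroup G] [Fintype G] (A : Finset G) (x : G) : ℝ :=
  ∑ y, ind A y * ind A (x + y)

lemma rep_nonneg {G : Type*} [AddCommGroup G] [Fintype G] (A : Finset G) (x : G) : 0 ≤ rep A x :=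
  Finset.sum_nonneg fun _ _ => mul_nonneg (ind_nonneg _ _) (ind_nonneg _ _)

lemma sum_rep {G : Type*} [AddCommGroup G] [Fintype G] (A : Finset G) :
    ∑ x, rep A x = (A.card : ℝ) ^ 2 := by
  unfold rep
  rw [Finset.sum_comm]
  simp_rw [← Finset.mul_sum]
  have h : ∀ y : G, ∑ x, ind A (x + y) = A.card := fun y => by
    rw [← sum_ind A]
    exact Fintype.sum_equiv (Equiv.addRight y) _ _ fun _ => rfl
  simp_rw [h, ← Finset.sum_mul, sum_ind, sq]

lemma sum_walk_zero_mul_ind {G : Type*} [AddCommGroup G] [Fintype G] (B S T : Finset G) :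
    ∑ g, walk B T 0 g * ind S g = (∑ x, ind S x * rep B x) / (B.card : ℝ) ^ 2 := by
  rw [sum_walk_zero_mul]
  congr 1
  simp only [rep, Finset.mul_sum]
  conv_rhs => rw [Finset.sum_comm]
  rw [← sum_ind_mul]
  refine Finset.sum_congr rfl fun y _ => ?_
  rw [← sum_ind_mul, Finset.mul_sum]
  refine (Fintype.sum_equiv (Equiv.addRight y) _ _ fun x => ?_).symm
  simp only [Equiv.coe_addRight, add_sub_cancel_right]
  ring

/-- Sifting by dependent random choice. -/
lemma exists_sifted {G : Type*} [AddCommGroup G] [Fintype G] (A S : Finset G) (p : ℕ) {η : ℝ}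
    (hη : 0 < η) (hbad : ∑ x, (1 - ind S x) * rep A x ^ p ≤ η * ∑ x, rep A x ^ p) :
    ∃ B : Finset G, ∑ x, (1 - ind S x) * rep B x ≤ 2 * η * (B.card : ℝ) ^ 2 ∧
      Fintype.card G * ∑ x, rep A x ^ p ≤ 2 * (B.card : ℝ) ^ 2 * (Fintype.card G : ℝ) ^ p := by
  have hG : (0 : ℝ) < Fintype.card G := by exact_mod_cast Fintype.card_pos
  set B : (Fin p → G) → Finset G := fun s => Finset.univ.filter fun y => ∀ i, y + s i ∈ A with hB
  have hind : ∀ s y, ind (B s) y = ∏ i, ind A (y + s i) := by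
    intro s y
    simp [ind, hB, Finset.prod_ite_zero]
  have hrep : ∀ x, ∑ s, rep (B s) x = Fintype.card G * rep A x ^ p := by
    intro x
    unfold rep
    rw [Finset.sum_comm]
    have h1 : ∀ y, ∑ s, ind (B s) y * ind (B s) (x + y)
        = (∑ y, ind A y * ind A (x + y)) ^ p := by
      intro y
      simp_rw [hind, ← Finset.prod_mul_distrib]
      rw [← Fintype.prod_sum (fun (_ : Fin p) a => ind A (y + a) * ind A (x + y + a)),
        Fin.prod_const]
      congr 1
      exact Fintype.sum_equiv (Equiv.addLeft y) _ _ fun a => by simp [add_assoc]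
    simp [h1]
  set Z := Fintype.card G * ∑ x, rep A x ^ p with hZ
  have hZ0 : 0 ≤ Z :=
    mul_nonneg hG.le (Finset.sum_nonneg fun _ _ => pow_nonneg (rep_nonneg _ _) _)
  have h1 : ∑ s, ((B s).card : ℝ) ^ 2 = Z := by
    simp_rw [← sum_rep]
    rw [Finset.sum_comm]
    simp_rw [hrep, hZ, Finset.mul_sum]
  have h2 : ∑ s, ∑ x, (1 - ind S x) * rep (B s) x ≤ η * Z := by
    rw [Finset.sum_comm]
    simp_rw [← Finset.mul_sum, hrep]
    calc _ = Fintype.card G * ∑ x, (1 - ind S x) * rep A x ^ p := by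
          rw [Finset.mul_sum]
          exact Finset.sum_congr rfl fun x _ => by ring
      _ ≤ Fintype.card G * (η * ∑ x, rep A x ^ p) := by gcongr
      _ = _ := by rw [hZ]; ring
  obtain ⟨s, -, hs⟩ : ∃ s ∈ (Finset.univ : Finset (Fin p → G)),
      (∑ x, (1 - ind S x) * rep (B s) x) / (2 * η) + Z / (2 * (Fintype.card G : ℝ) ^ p)
        ≤ ((B s).card : ℝ) ^ 2 := by
    refine Finset.exists_le_of_sum_le ⟨fun _ => 0, Finset.mem_univ _⟩ ?_
    rw [h1, Finset.sum_add_distrib, ← Finset.sum_div]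
    have h3 : (∑ s, ∑ x, (1 - ind S x) * rep (B s) x) / (2 * η) ≤ Z / 2 := by
      rw [div_le_iff₀ (by positivity)]
      linarith
    have h4 : ∑ _s : Fin p → G, Z / (2 * (Fintype.card G : ℝ) ^ p) = Z / 2 := by
      simp
      field_simp
    linarith
  have h5 : 0 ≤ (∑ x, (1 - ind S x) * rep (B s) x) / (2 * η) :=
    div_nonneg (Finset.sum_nonneg fun x _ =>
      mul_nonneg (sub_nonneg.2 (ind_le_one _ _)) (rep_nonneg _ _)) (by positivity)
  have h6 : 0 ≤ Z / (2 * (Fintype.card G : ℝ) ^ p) := by positivity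
  refine ⟨B s, ?_, ?_⟩
  · have : (∑ x, (1 - ind S x) * rep (B s) x) / (2 * η) ≤ ((B s).card : ℝ) ^ 2 := by linarith
    rw [div_le_iff₀ (by positivity)] at this
    linarith
  · have : Z / (2 * (Fintype.card G : ℝ) ^ p) ≤ ((B s).card : ℝ) ^ 2 := by linarith
    rw [div_le_iff₀ (by positivity)] at this
    linarith

/-- Monotonicity of power means, in multiplicative form. -/
lemma card_mul_pow_le_sum_pow {ι : Type*} [Fintype ι] {u : ι → ℝ} (hu : ∀ x, 0 ≤ u x) {c : ℝ}
    (hc : 0 < c) {k p : ℕ} (hk : 0 < k) (hkp : k ≤ p)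
    (h : Fintype.card ι * c ^ k ≤ ∑ x, u x ^ k) : Fintype.card ι * c ^ p ≤ ∑ x, u x ^ p := by
  have hk' : (0 : ℝ) < k := by exact_mod_cast hk
  have h1 : ∀ x, 1 + (p / k : ℝ) * (u x ^ k / c ^ k - 1) ≤ u x ^ p / c ^ p := by
    intro x
    have h2 : (0 : ℝ) ≤ u x ^ k / c ^ k := by have := hu x; positivity
    have h3 : (1 : ℝ) ≤ p / k := by
      rw [le_div_iff₀ hk', one_mul]; exact_mod_cast hkp
    have h4 := one_add_mul_self_le_rpow_one_add (s := u x ^ k / c ^ k - 1) (by linarith) h3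
    refine h4.trans_eq ?_
    rw [add_sub_cancel, ← div_pow, ← div_pow, ← Real.rpow_natCast, ← Real.rpow_mul
      (div_nonneg (hu x) hc.le), mul_div_cancel₀ _ hk'.ne', Real.rpow_natCast]
  have h5 := Finset.sum_le_sum fun x (_ : x ∈ Finset.univ) => h1 x
  rw [← Finset.sum_div, Finset.sum_add_distrib, ← Finset.mul_sum, Finset.sum_sub_distrib,
    ← Finset.sum_div] at h5
  simp only [Finset.sum_const, nsmul_eq_mul, mul_one, Finset.card_univ] at h5
  have h6 : 0 ≤ (p / k : ℝ) * ((∑ x, u x ^ k) / c ^ k - Fintype.card ι) := by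
    refine mul_nonneg (by positivity) (sub_nonneg.2 ?_)
    rwa [le_div_iff₀ (by positivity)]
  have h7 : (Fintype.card ι : ℝ) ≤ (∑ x, u x ^ p) / c ^ p := by linarith
  rwa [le_div_iff₀ (by positivity)] at h7

/-- If `A ⋆ A` has large `ν`-average on every shift by `w ∈ W`, then `A` is dense on a coset
of `W`. -/
lemma exists_dense_coset {F V : Type*} [Field F] [AddCommGroup V] [Module F V] [Fintype V]
    {A : Finset V} (hA : A.Nonempty) (W : Submodule F V) {ν : V → ℝ} (hν : ∀ g, 0 ≤ ν g)
    (hν1 : ∑ g, ν g = 1) {c : ℝ}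
    (h : ∀ w ∈ W, c ≤ ∑ g, ν g * (Fintype.card V * rep A (g + w) / (A.card : ℝ) ^ 2)) :
    ∃ θ : V, c * A.card * Nat.card W ≤
      ((A.filter fun x => x - θ ∈ W).card : ℝ) * Fintype.card V := by
  have hA' : (0 : ℝ) < A.card := by exact_mod_cast hA.card_pos
  obtain ⟨θ, hθ⟩ := Finite.exists_max fun θ : V => (A.filter fun x => x - θ ∈ W).card
  refine ⟨θ, ?_⟩
  set K := (A.filter fun x => x - θ ∈ W).card with hK
  set Wf := Finset.univ.filter fun w : V => w ∈ W with hWf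
  have hW : (Nat.card W : ℝ) = Wf.card := by
    rw [Nat.card_eq_fintype_card, Fintype.card_subtype]
  have h1 : ∀ g, ∑ w ∈ Wf, rep A (g + w) ≤ A.card * K := by
    intro g
    unfold rep
    rw [Finset.sum_comm]
    simp_rw [← Finset.mul_sum]
    rw [sum_ind_mul]
    have h2 : ∀ y ∈ A, ∑ w ∈ Wf, ind A (g + w + y) ≤ K := by
      intro y _
      refine le_trans (le_of_eq ?_) (Nat.cast_le.2 (hθ (g + y)))
      rw [← sum_ind_mul, ← sum_ind]
      refine Fintype.sum_equiv (Equiv.addRight (g + y)) _ _ fun w => ?_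
      simp only [ind, hWf, Finset.mem_filter, Finset.mem_univ, true_and, Equiv.coe_addRight,
        add_sub_cancel_right]
      rw [show g + w + y = w + (g + y) by abel]
      split_ifs <;> simp_all
    refine (Finset.sum_le_sum h2).trans_eq ?_
    simp
  have h3 : (Wf.card : ℝ) * c ≤ Fintype.card V * K / A.card := by
    calc (Wf.card : ℝ) * c = ∑ w ∈ Wf, c := by simp
      _ ≤ ∑ w ∈ Wf, ∑ g, ν g * (Fintype.card V * rep A (g + w) / (A.card : ℝ) ^ 2) :=
        Finset.sum_le_sum fun w hw => h w (Finset.mem_filter.1 hw).2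
      _ = ∑ g, ν g * (Fintype.card V / (A.card : ℝ) ^ 2 * ∑ w ∈ Wf, rep A (g + w)) := by
        rw [Finset.sum_comm]
        refine Finset.sum_congr rfl fun g _ => ?_
        rw [Finset.mul_sum, Finset.mul_sum]
        exact Finset.sum_congr rfl fun w _ => by ring
      _ ≤ ∑ g, ν g * (Fintype.card V / (A.card : ℝ) ^ 2 * (A.card * K)) :=
        Finset.sum_le_sum fun g _ => by
          have := h1 g
          have := hν g
          gcongr
      _ = Fintype.card V * K / A.card := by
        rw [← Finset.sum_mul, hν1]
        field_simp
  rw [le_div_iff₀ hA'] at h3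
  rw [hW]
  linarith

/-- Almost periodicity of `B ⋆ B` relative to a subspace of bounded codimension. -/
lemma exists_submodule_almost_invariant {F : Type*} [Field F] [Fintype F] {n : ℕ}
    {B : Finset (Fin n → F)} (S : Finset (Fin n → F)) (hB : B.Nonempty) {D ε : ℝ} (hD : 1 ≤ D)
    (hε : 0 < ε) (hε1 : ε ≤ 1)
    (hB2 : (Fintype.card (Fin n → F) : ℝ) / B.card ≤ Real.exp (2 * D))
    (hB3 : Real.exp (-(3 * D)) * ((Fintype.card (Fin n → F) : ℝ) / B.card) ≤ ε / 64) :
    ∃ (W : Submodule F (Fin n → F)) (ν : (Fin n → F) → ℝ),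
      (n : ℝ) - Module.finrank F W ≤ 2264924160 * (D ^ 4 / ε ^ 2) ∧
      (∀ g, 0 ≤ ν g) ∧ ∑ g, ν g = 1 ∧
      ∀ w ∈ W, (∑ x, ind S x * rep B x) / (B.card : ℝ) ^ 2 - ε / 16
        ≤ ∑ g, ν g * ind S (g + w) := by
  have hBc : (0 : ℝ) < B.card := by exact_mod_cast hB.card_pos
  have hG : (0 : ℝ) < Fintype.card (Fin n → F) := by exact_mod_cast Fintype.card_pos
  set N : ℝ := (Fintype.card (Fin n → F) : ℝ) with hN
  set ψ := AddChar.FiniteField.primitiveChar_to_Complex F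
  have hψ : ψ ≠ 1 := by
    have := AddChar.FiniteField.primitiveChar_to_Complex_isPrimitive F one_ne_zero
    rwa [AddChar.mulShift_one] at this
  set l := ⌈3 * D⌉₊ with hl
  have hl1 : 3 * D ≤ l := Nat.le_ceil _
  have hl2 : (l : ℝ) ≤ 4 * D := by
    have := Nat.ceil_lt_add_one (by linarith : 0 ≤ 3 * D)
    linarith
  have hl3 : (1 : ℝ) ≤ l := by linarith
  have hl0 : (0 : ℝ) < l := by linarith
  set δ : ℝ := ε / (128 * l) with hδ
  have hδ0 : 0 < δ := by positivity
  have hδ1 : δ ≤ 1 := by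
    rw [hδ, div_le_one (by positivity)]
    linarith
  have hq : 1 ≤ l / δ ^ 2 := by
    rw [le_div_iff₀ (by positivity)]
    nlinarith
  set m := ⌈44 * (l / δ ^ 2)⌉₊ with hm
  have hm1 : 44 * (l / δ ^ 2) ≤ m := Nat.le_ceil _
  have hm2 : (m : ℝ) ≤ 45 * (l / δ ^ 2) := by
    have := Nat.ceil_lt_add_one (by linarith : 0 ≤ 44 * (l / δ ^ 2))
    linarith
  have hm3 : (1 : ℝ) ≤ m := by linarith
  obtain ⟨T, hTc, hT⟩ := exists_almost_periods B S hB m (by exact_mod_cast hm3) δ hδ0.le hδ1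
  rw [← hN] at hTc
  have hTpos : (0 : ℝ) < T.card := by
    have : 0 < T.card * N ^ m := lt_of_lt_of_le (by positivity) hTc
    exact pos_of_mul_pos_left this (by positivity)
  have hTne : T.Nonempty := Finset.card_pos.1 (by exact_mod_cast hTpos)
  obtain ⟨W, hWdim, hW⟩ := exists_submodule_annihilating_spectrum hψ hTne
  have hexp : δ ^ 2 * m / 4 ≥ 11 * l := by
    have : δ ^ 2 * (44 * (l / δ ^ 2)) ≤ δ ^ 2 * m := by gcongr
    have h2 : δ ^ 2 * (44 * (l / δ ^ 2)) = 44 * l := by field_simp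
    linarith
  have hexpl : Real.exp (-l) ≤ Real.exp (-(3 * D)) := Real.exp_le_exp.2 (by linarith)
  have hloss1 : l * (2 * δ + 8 * Real.exp (-(δ ^ 2 * m / 4)) * N / B.card) ≤ ε / 32 := by
    have h1 : l * (2 * δ) = ε / 64 := by rw [hδ]; field_simp; norm_num
    have h2 : 8 * l * Real.exp (-(δ ^ 2 * m / 4)) ≤ Real.exp (-(3 * D)) := by
      calc 8 * l * Real.exp (-(δ ^ 2 * m / 4)) ≤ Real.exp (8 * l) * Real.exp (-(11 * l)) := by
            gcongr
            linarith [Real.add_one_le_exp (8 * l : ℝ)]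
        _ = Real.exp (-(3 * l)) := by rw [← Real.exp_add]; congr 1; ring
        _ ≤ _ := Real.exp_le_exp.2 (by linarith)
    have h3 : l * (8 * Real.exp (-(δ ^ 2 * m / 4)) * N / B.card) ≤ ε / 64 := by
      refine le_trans (le_of_eq ?_) ((mul_le_mul_of_nonneg_right h2 (by positivity)).trans hB3)
      ring
    linarith
  have hloss2 : 2 * (1 / 4) ^ l * N / B.card ≤ ε / 32 := by
    have h1 : (1 / 4 : ℝ) ^ l ≤ Real.exp (-(3 * D)) := by
      refine le_trans ?_ hexpl
      have h2 : (1 / 4 : ℝ) ≤ Real.exp (-1) := by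
        rw [Real.exp_neg, one_div]
        have := Real.exp_one_lt_d9
        gcongr
        linarith
      calc (1 / 4 : ℝ) ^ l ≤ Real.exp (-1) ^ l := by gcongr
        _ = Real.exp (-l) := by rw [← Real.exp_nat_mul]; congr 1; ring
    have h3 := (mul_le_mul_of_nonneg_right h1 (by positivity : 0 ≤ N / B.card)).trans hB3
    have h4 : 2 * (1 / 4) ^ l * N / B.card = 2 * ((1 / 4) ^ l * (N / B.card)) := by ring
    linarith
  refine ⟨W, walk B T l, ?_, walk_nonneg B T l, sum_walk hB hTne l, fun w hw => ?_⟩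
  · have h1 : N / T.card ≤ Real.exp (3 * D * m) := by
      have h2 : N / T.card ≤ 2 * (N / B.card) ^ m := by
        rw [div_le_iff₀ hTpos, div_pow]
        rw [← mul_le_mul_iff_left₀ (by positivity : (0 : ℝ) < (B.card : ℝ) ^ m / 2)]
        refine (le_of_eq ?_).trans (hTc.trans (le_of_eq ?_))
        · ring
        · field_simp
      refine h2.trans ?_
      calc 2 * (N / B.card) ^ m ≤ Real.exp 1 * Real.exp (2 * D) ^ m := by
            gcongr
            linarith [Real.add_one_le_exp (1 : ℝ)]
        _ = Real.exp (1 + m * (2 * D)) := by rw [← Real.exp_nat_mul, ← Real.exp_add]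
        _ ≤ _ := Real.exp_le_exp.2 (by nlinarith)
    have h2 : Real.log (N / T.card) ≤ 3 * D * m := by
      rw [Real.log_le_iff_le_exp (by positivity)]; exact h1
    calc (n : ℝ) - Module.finrank F W ≤ 16 * (3 * D * m) := hWdim.trans (by linarith)
      _ ≤ 16 * (3 * D * (45 * (l / δ ^ 2))) := by gcongr
      _ = 35389440 * D * l ^ 3 / ε ^ 2 := by rw [hδ]; field_simp; norm_num
      _ ≤ 35389440 * D * (4 * D) ^ 3 / ε ^ 2 := by gcongr
      _ = _ := by ring
  · have h1 := walk_zero_sub_le hB hTne (by positivity) hT l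
    have h2 := walk_hit_sub_le (dotChar ψ)
      (fun x => by convert sum_dotChar hψ x) (T := T) hB S l (hW w hw)
    rw [sum_walk_zero_mul_ind] at h1
    linarith

/-- A large value of `∑ (N·rep A / |A|²)^p` for suitably large `p` gives a density increment. -/
lemma exists_dense_coset_of_sum_pow {F : Type*} [Field F] [Fintype F] {n : ℕ}
    {A : Finset (Fin n → F)} (hA : A.Nonempty) {d ε : ℝ} (hd : 1 ≤ d) (hε : 0 < ε) (hε1 : ε ≤ 1)
    (hAd : (Fintype.card (Fin n → F) : ℝ) / A.card ≤ 2 ^ d) {p : ℕ}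
    (hp : 24 * Real.log (2 / ε) ≤ ε * p)
    (hsum : (Fintype.card (Fin n → F) : ℝ) * (1 + ε) ^ p ≤
      ∑ x, (Fintype.card (Fin n → F) * rep A x / (A.card : ℝ) ^ 2) ^ p) :
    ∃ (W : Submodule F (Fin n → F)) (θ : Fin n → F),
      (n : ℝ) - Module.finrank F W ≤ 2264924160 * ((d * p) ^ 4 / ε ^ 2) ∧
      (1 + ε / 4) * A.card * Nat.card W ≤
        ((A.filter fun x => x - θ ∈ W).card : ℝ) * Fintype.card (Fin n → F) := by
  have hAc : (0 : ℝ) < A.card := by exact_mod_cast hA.card_pos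
  have hG : (0 : ℝ) < Fintype.card (Fin n → F) := by exact_mod_cast Fintype.card_pos
  set N : ℝ := (Fintype.card (Fin n → F) : ℝ) with hN
  set u : (Fin n → F) → ℝ := fun x => N * rep A x / (A.card : ℝ) ^ 2 with hu
  have hu0 : ∀ x, 0 ≤ u x := fun x => by have := rep_nonneg A x; positivity
  have hlog2 : (0.69 : ℝ) ≤ Real.log (2 / ε) := by
    have h1 := Real.log_two_gt_d9
    have h2 : Real.log 2 ≤ Real.log (2 / ε) := by
      gcongr
      rw [le_div_iff₀ hε]; linarith
    linarith
  have hp16 : (16 : ℝ) ≤ p := by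
    have : ε * p ≤ p := mul_le_of_le_one_left (by positivity) hε1
    linarith
  have hpd : (p : ℝ) ≤ d * p := le_mul_of_one_le_left (by positivity) hd
  have hD : 16 ≤ d * p := by linarith
  have hε64 : Real.exp (-(ε * p / 4)) ≤ ε / 64 := by
    have h1 : Real.exp (-(6 * Real.log (2 / ε))) = (ε / 2) ^ 6 := by
      rw [show -(6 * Real.log (2 / ε)) = (6 : ℕ) * Real.log (ε / 2) by
        rw [← inv_div, Real.log_inv]; push_cast; ring, Real.exp_nat_mul, Real.exp_log (by positivity)]
    calc Real.exp (-(ε * p / 4)) ≤ Real.exp (-(6 * Real.log (2 / ε))) :=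
          Real.exp_le_exp.2 (by linarith)
      _ = ε / 64 * ε ^ 5 := by rw [h1]; ring
      _ ≤ ε / 64 := mul_le_of_le_one_right (by positivity) (pow_le_one₀ hε.le hε1)
  set S := Finset.univ.filter fun x => 1 + ε / 2 < u x with hS
  have hbadu : ∑ x, (1 - ind S x) * u x ^ p ≤ ε / 64 * ∑ x, u x ^ p := by
    have h1 : ∀ x, (1 - ind S x) * u x ^ p ≤ (1 + ε / 2) ^ p := by
      intro x
      unfold ind
      split_ifs with hx
      · simp; positivity
      · simp only [hS, Finset.mem_filter, Finset.mem_univ, true_and, not_lt] at hx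
        have := hu0 x
        rw [sub_zero, one_mul]
        gcongr
    have h2 : (1 + ε / 2) ^ p ≤ ε / 64 * (1 + ε) ^ p := by
      have h3 : 1 + ε / 2 ≤ Real.exp (-(ε / 4)) * (1 + ε) := by
        have := Real.add_one_le_exp (-(ε / 4))
        nlinarith
      calc (1 + ε / 2) ^ p ≤ (Real.exp (-(ε / 4)) * (1 + ε)) ^ p := by gcongr
        _ = Real.exp (-(ε * p / 4)) * (1 + ε) ^ p := by
          rw [mul_pow, ← Real.exp_nat_mul]; congr 2; ring
        _ ≤ _ := by gcongr
    calc _ ≤ ∑ _x : Fin n → F, (1 + ε / 2) ^ p := Finset.sum_le_sum fun x _ => h1 x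
      _ = N * (1 + ε / 2) ^ p := by simp [hN]
      _ ≤ N * (ε / 64 * (1 + ε) ^ p) := by gcongr
      _ = ε / 64 * (N * (1 + ε) ^ p) := by ring
      _ ≤ _ := by gcongr
  have hup : ∀ x, u x ^ p = (N / (A.card : ℝ) ^ 2) ^ p * rep A x ^ p := fun x => by
    rw [← mul_pow, hu]; congr 1; ring
  have hNA : 0 < (N / (A.card : ℝ) ^ 2) ^ p := by positivity
  obtain ⟨B, hB1, hB2⟩ := exists_sifted A S p (η := ε / 64) (by positivity) (by
    rw [← mul_le_mul_iff_right₀ hNA]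
    refine (le_of_eq ?_).trans (hbadu.trans (le_of_eq ?_))
    · rw [Finset.mul_sum]
      exact Finset.sum_congr rfl fun x _ => by rw [hup]; ring
    · simp_rw [hup, ← Finset.mul_sum]; ring)
  have hBN : N ^ 2 ≤ 2 * (B.card : ℝ) ^ 2 * ((2 : ℝ) ^ d) ^ (2 * p) := by
    have h1 : N ≤ (N / (A.card : ℝ) ^ 2) ^ p * ∑ x, rep A x ^ p := by
      rw [Finset.mul_sum]
      simp_rw [← hup]
      refine le_trans ?_ hsum
      exact le_mul_of_one_le_right hG.le (one_le_pow₀ (by linarith))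
    calc N ^ 2 = N * N := sq N
      _ ≤ N * ((N / (A.card : ℝ) ^ 2) ^ p * ∑ x, rep A x ^ p) := by gcongr
      _ = (N / (A.card : ℝ) ^ 2) ^ p * (N * ∑ x, rep A x ^ p) := by ring
      _ ≤ (N / (A.card : ℝ) ^ 2) ^ p * (2 * (B.card : ℝ) ^ 2 * N ^ p) := by gcongr
      _ = 2 * (B.card : ℝ) ^ 2 * (N / A.card) ^ (2 * p) := by
        rw [pow_mul, div_pow N _ 2, div_pow, div_pow, pow_right_comm]; ring
      _ ≤ _ := by gcongr
  have hBpos : (0 : ℝ) < B.card := by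
    rcases Nat.eq_zero_or_pos B.card with h | h
    · rw [h] at hBN
      simp at hBN
      exact absurd hBN hG.ne'
    · exact_mod_cast h
  have hBne : B.Nonempty := Finset.card_pos.1 (by exact_mod_cast hBpos)
  have hratio : N / B.card ≤ Real.exp (2 * (d * p)) := by
    refine le_of_sq_le_sq ?_ (Real.exp_pos _).le
    rw [div_pow, div_le_iff₀ (by positivity)]
    have h2 : ((2 : ℝ) ^ d) ^ (2 * p) = Real.exp (2 * (d * p) * Real.log 2) := by
      rw [← Real.rpow_mul_natCast (by norm_num), Real.rpow_def_of_pos (by norm_num)]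
      congr 1; push_cast; ring
    have h3 : 2 * Real.exp (2 * (d * p) * Real.log 2) ≤ Real.exp (2 * (d * p)) ^ 2 := by
      calc _ ≤ Real.exp 1 * Real.exp (2 * (d * p)) := by
            have := Real.log_two_lt_d9
            refine mul_le_mul (by linarith [Real.add_one_le_exp (1 : ℝ)])
              (Real.exp_le_exp.2 (by nlinarith)) (Real.exp_pos _).le (Real.exp_pos _).le
        _ = Real.exp (1 + 2 * (d * p)) := by rw [← Real.exp_add]
        _ ≤ Real.exp ((2 : ℕ) * (2 * (d * p))) := Real.exp_le_exp.2 (by push_cast; linarith)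
        _ = _ := Real.exp_nat_mul _ _
    rw [h2] at hBN
    calc N ^ 2 ≤ _ := hBN
      _ = (2 * Real.exp (2 * (d * p) * Real.log 2)) * (B.card : ℝ) ^ 2 := by ring
      _ ≤ _ := by gcongr
  have hratio2 : Real.exp (-(3 * (d * p))) * (N / B.card) ≤ ε / 64 := by
    refine le_trans ?_ hε64
    calc _ ≤ Real.exp (-(3 * (d * p))) * Real.exp (2 * (d * p)) := by gcongr
      _ = Real.exp (-(d * p)) := by rw [← Real.exp_add]; congr 1; ring
      _ ≤ _ := Real.exp_le_exp.2 (by nlinarith)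
  obtain ⟨W, ν, hW, hν, hν1, hinv⟩ := exists_submodule_almost_invariant S hBne
    (by linarith : 1 ≤ d * p) hε hε1 hratio hratio2
  have hhit : 1 - ε / 32 ≤ (∑ x, ind S x * rep B x) / (B.card : ℝ) ^ 2 := by
    rw [le_div_iff₀ (by positivity)]
    have h1 : ∑ x, (1 - ind S x) * rep B x = (B.card : ℝ) ^ 2 - ∑ x, ind S x * rep B x := by
      rw [← sum_rep, ← Finset.sum_sub_distrib]
      exact Finset.sum_congr rfl fun x _ => by ring
    rw [h1] at hB1
    linarith
  obtain ⟨θ, hθ⟩ := exists_dense_coset hA W hν hν1 (c := 1 + ε / 4) fun w hw => by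
    have h1 := hinv w hw
    have h2 : (1 + ε / 2) * ∑ g, ν g * ind S (g + w) ≤ ∑ g, ν g * u (g + w) := by
      rw [Finset.mul_sum]
      refine Finset.sum_le_sum fun g _ => ?_
      rw [mul_left_comm]
      refine mul_le_mul_of_nonneg_left ?_ (hν g)
      unfold ind
      split_ifs with hg
      · rw [mul_one]
        exact (Finset.mem_filter.1 hg).2.le
      · rw [mul_zero]
        exact hu0 _
    refine le_trans ?_ h2
    nlinarith
  exact ⟨W, θ, hW, hθ⟩

lemma starC_dens_self {G : Type*} [AddCommGroup G] [Fintype G] (A : Finset G) (x : G) :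
    starC (dens A) (dens A) x = Fintype.card G * rep A x / (A.card : ℝ) ^ 2 := by
  have hG : (Fintype.card G : ℝ) ≠ 0 := by exact_mod_cast Fintype.card_ne_zero
  have h : ∀ y, dens A y = ind A y * (Fintype.card G / A.card) := by
    intro y
    unfold dens ind
    split_ifs <;> simp
  simp only [starC, h, rep]
  rw [div_eq_iff hG, Finset.mul_sum, Finset.sum_div, Finset.sum_mul]
  exact Finset.sum_congr rfl fun y _ => by ring

/-- Structure vs. pseudorandomness in `𝔽_q^n`: if `‖A ⋆ A‖_k ≥ 1 + ε` then `A` has a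
density increment on an affine subspace of bounded codimension. -/
theorem density_increment_from_self_star_norm :
    ∃ C : ℝ, 1 ≤ C ∧ ∀ (F : Type) [Field F] [Fintype F] [DecidableEq F] (n : ℕ), 1 ≤ n →
      ∀ d : ℝ, 1 ≤ d → ∀ A : Finset (Fin n → F), ∀ k : ℕ, 1 ≤ k →
      ∀ ε : ℝ, 0 < ε → ε ≤ 1 →
      (2:ℝ) ^ (-d) * (Fintype.card F : ℝ) ^ n ≤ A.card →
      1 + ε ≤ knorm k (starC (dens A) (dens A)) →
      ∃ (W : Submodule F (Fin n → F)) (θ : Fin n → F),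
        ((n:ℝ) - Module.finrank F W) ≤
          C * (d ^ 4 * k ^ 4 / ε ^ 2 + d ^ 4 * Real.log (2/ε) ^ 4 / ε ^ 6) ∧
        (1 + ε/4) * (A.card : ℝ) * (Nat.card W : ℝ) ≤
          ((A.filter fun x => x - θ ∈ W).card : ℝ) * (Fintype.card F : ℝ) ^ n := by
  refine ⟨2264924160 * (8 * 26 ^ 4), by norm_num, ?_⟩
  intro F _ _ _ n _ d hd A k hk ε hε hε1 hA hnorm
  have hcard : (Fintype.card (Fin n → F) : ℝ) = (Fintype.card F : ℝ) ^ n := by simp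
  have hG : (0 : ℝ) < Fintype.card (Fin n → F) := by exact_mod_cast Fintype.card_pos
  rw [← hcard] at hA ⊢
  have hAc : (0 : ℝ) < A.card := lt_of_lt_of_le (by positivity) hA
  have hAne : A.Nonempty := Finset.card_pos.1 (by exact_mod_cast hAc)
  have hk' : (0 : ℝ) < k := by exact_mod_cast hk
  set L := Real.log (2 / ε) with hL
  have hL1 : (1 / 2 : ℝ) ≤ L := by
    have h1 := Real.log_two_gt_d9
    have h2 : Real.log 2 ≤ Real.log (2 / ε) := by
      gcongr
      rw [le_div_iff₀ hε]; linarith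
    linarith
  have hLε : 1 / 2 ≤ L / ε := by
    rw [le_div_iff₀ hε]; nlinarith
  set p := k + ⌈24 * (L / ε)⌉₊ with hp
  have hp1 : 24 * (L / ε) ≤ p := by
    have := Nat.le_ceil (24 * (L / ε))
    rw [hp]; push_cast; linarith
  have hp2 : (p : ℝ) ≤ k + 26 * (L / ε) := by
    have := Nat.ceil_lt_add_one (by linarith : 0 ≤ 24 * (L / ε))
    rw [hp]; push_cast; linarith
  have hp4 : (p : ℝ) ^ 4 ≤ 8 * 26 ^ 4 * (k ^ 4 + L ^ 4 / ε ^ 4) := by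
    have h1 : (p : ℝ) ^ 4 ≤ (k + 26 * (L / ε)) ^ 4 := by gcongr
    have h2 := add_pow_le hk'.le (by linarith : 0 ≤ 26 * (L / ε)) 4
    have h3 : (26 * (L / ε)) ^ 4 = 26 ^ 4 * (L ^ 4 / ε ^ 4) := by rw [mul_pow, div_pow]
    have h4 : 0 ≤ (k : ℝ) ^ 4 := by positivity
    rw [h3] at h2
    norm_num at h2 ⊢
    linarith
  have hsumk : (Fintype.card (Fin n → F) : ℝ) * (1 + ε) ^ k ≤
      ∑ x, (Fintype.card (Fin n → F) * rep A x / (A.card : ℝ) ^ 2) ^ k := by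
    have h1 : ∀ x, |starC (dens A) (dens A) x| =
        Fintype.card (Fin n → F) * rep A x / (A.card : ℝ) ^ 2 := fun x => by
      rw [starC_dens_self, abs_of_nonneg]
      have := rep_nonneg A x
      positivity
    unfold knorm at hnorm
    simp_rw [h1] at hnorm
    have h2 : (0 : ℝ) ≤ (∑ x, (Fintype.card (Fin n → F) * rep A x / (A.card : ℝ) ^ 2) ^ k) /
        Fintype.card (Fin n → F) :=
      div_nonneg (Finset.sum_nonneg fun x _ => by have := rep_nonneg A x; positivity) hG.le
    have h3 := pow_le_pow_left₀ (by linarith : 0 ≤ 1 + ε) hnorm k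
    rw [← Real.rpow_mul_natCast h2, one_div_mul_cancel hk'.ne', Real.rpow_one,
      le_div_iff₀ hG] at h3
    linarith
  have hsum := card_mul_pow_le_sum_pow (fun x => by have := rep_nonneg A x; positivity)
    (by linarith : 0 < 1 + ε) hk (Nat.le_add_right k ⌈24 * (L / ε)⌉₊) hsumk
  obtain ⟨W, θ, hW, hθ⟩ := exists_dense_coset_of_sum_pow hAne hd hε hε1 (by
    rw [div_le_iff₀ hAc]
    rw [Real.rpow_neg (by norm_num), inv_mul_le_iff₀ (by positivity)] at hA
    exact hA) (p := p) (by
    have := mul_le_mul_of_nonneg_left hp1 hε.le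
    refine (le_of_eq ?_).trans this
    rw [← hL]
    field_simp) hsum
  refine ⟨W, θ, hW.trans ?_, hθ⟩
  rw [mul_pow]
  calc 2264924160 * (d ^ 4 * (p : ℝ) ^ 4 / ε ^ 2)
      ≤ 2264924160 * (d ^ 4 * (8 * 26 ^ 4 * (k ^ 4 + L ^ 4 / ε ^ 4)) / ε ^ 2) := by gcongr
    _ = _ := by field_simp
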